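/- arXiv:2204.14153 — 2 statements merged into one kernel-verified Lean document; each statement's English description precedes it below -/
import Mathlib

section
/- Let 𝒳 be a finite normal G-automaton with initial state x, and let T = (S, E, row) be a closed deterministic observation table with row(t)(e) = 1 iff te ∈ ⟦𝒳⟧ for all t ∈ S ∪ S·(At·Σ) and e ∈ E. Let π be the injection sending row(s) to s⁻¹⟦𝒳⟧. Then the following are equivalent: (1) π is a G-automata isomorphism from m(T) to m(𝒳); (2) ⟦m(T)⟧ = ⟦m(𝒳)⟧. -/
open scoped Classical

/-- Guarded strings `GS = (At·Σ)*·At`, represented as a pair of a word in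
`(At·Σ)*` (the guarded string without terminating atom) and a terminating atom. -/
abbrev GS (At Act : Type*) := List (At × Act) × At

variable {At Act X Y : Type*}

/-- Acceptance of a guarded string by a state of a `G`-coalgebra. -/
def GAccepts (δ : X → At → Bool ⊕ (Act × X)) : X → List (At × Act) → At → Prop
  | x, [], β => δ x β = Sum.inl true
  | x, (α, p) :: w, β => ∃ y, δ x α = Sum.inr (p, y) ∧ GAccepts δ y w β

/-- The language `⟦x⟧ ⊆ GS` of a state of a `G`-coalgebra. -/
def glang (δ : X → At → Bool ⊕ (Act × X)) (x : X) : Set (GS At Act) :=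
  {g | GAccepts δ x g.1 g.2}

/-- The transition relation `x →^w y` of a `G`-coalgebra. -/
inductive GReaches (δ : X → At → Bool ⊕ (Act × X)) : X → List (At × Act) → X → Prop
  | refl (x : X) : GReaches δ x [] x
  | single {x : X} {α : At} {p : Act} {y : X} :
      δ x α = Sum.inr (p, y) → GReaches δ x [(α, p)] y
  | snoc {x y z : X} {v : List (At × Act)} {α : At} {p : Act} :
      GReaches δ x v y → δ y α = Sum.inr (p, z) → GReaches δ x (v ++ [(α, p)]) z

/-- The set `r(x)` of states reachable from `x`. -/
def grState (δ : X → At → Bool ⊕ (Act × X)) (x : X) : Set X :=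
  {y | ∃ w, GReaches δ x w y}

/-- The set `R(x)` of words witnessing reachability from `x`. -/
def gRWords (δ : X → At → Bool ⊕ (Act × X)) (x : X) : Set (List (At × Act)) :=
  {w | ∃ y, GReaches δ x w y}

/-- A `G`-coalgebra is normal if it only transitions to live states. -/
def GNormal (δ : X → At → Bool ⊕ (Act × X)) : Prop :=
  ∀ x α p y, δ x α = Sum.inr (p, y) → (glang δ y).Nonempty

/-- The derivative `w⁻¹L` of a guarded-string language. -/
def gderiv (w : List (At × Act)) (L : Set (GS At Act)) : Set (GS At Act) :=
  {u | (w ++ u.1, u.2) ∈ L}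

/-- The transition map of the minimization `m(𝒳)` (defined on all of `Set GS`). -/
noncomputable def minDelta : Set (GS At Act) → At → Bool ⊕ (Act × Set (GS At Act)) :=
  fun L α =>
    if h : ∃ p : Act, (gderiv [(α, p)] L).Nonempty then
      Sum.inr (h.choose, gderiv [(α, h.choose)] L)
    else if (([], α) : GS At Act) ∈ L then Sum.inl true
    else Sum.inl false

/-- The state space `{w⁻¹⟦𝒳⟧ | w ∈ R(x)}` of the minimization `m(𝒳)`. -/
def MinStates (δ : X → At → Bool ⊕ (Act × X)) (x : X) : Set (Set (GS At Act)) :=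
  {L | ∃ w ∈ gRWords δ x, L = gderiv w (glang δ x)}

/-- Restriction of a `G`-coalgebra to an invariant subset of states. -/
def grestrict (δ : X → At → Bool ⊕ (Act × X)) (A : Set X)
    (hA : ∀ y ∈ A, ∀ (α : At) (p : Act) (z : X), δ y α = Sum.inr (p, z) → z ∈ A) :
    A → At → Bool ⊕ (Act × A) := fun y α =>
  match h : δ y.val α with
  | Sum.inl b => Sum.inl b
  | Sum.inr (p, z) => Sum.inr (p, ⟨z, hA y.val y.2 α p z h⟩)

/-- Compatibility of two guarded strings: they agree on their first `n` actions
(or lack thereof) whenever they agree on their first `n` atoms. -/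
def GCompat : List (At × Act) → At → List (At × Act) → At → Prop
  | [], _, [], _ => True
  | [], β, (α, _) :: _, _ => β ≠ α
  | (α, _) :: _, _, [], β => β ≠ α
  | (α, p) :: u, β, (α', p') :: u', β' => α = α' → p = p' ∧ GCompat u β u' β'

/-- A guarded-string language is deterministic if any two of its strings that agree
on their first `n` atoms also agree on their first `n` actions (or lack thereof). -/
def GDetLang (L : Set (GS At Act)) : Prop :=
  ∀ u ∈ L, ∀ v ∈ L, GCompat u.1 u.2 v.1 v.2

/-- Bisimulations between `G`-coalgebras. -/
def IsGBisim (δX : X → At → Bool ⊕ (Act × X)) (δY : Y → At → Bool ⊕ (Act × Y))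
    (R : X → Y → Prop) : Prop :=
  ∀ x y, R x y → ∀ α : At,
    (∀ b : Bool, δX x α = Sum.inl b → δY y α = Sum.inl b) ∧
    (∀ p x', δX x α = Sum.inr (p, x') → ∃ y', δY y α = Sum.inr (p, y') ∧ R x' y')

/-- Bisimilarity of states of `G`-coalgebras. -/
def GBisimilar (δX : X → At → Bool ⊕ (Act × X)) (δY : Y → At → Bool ⊕ (Act × Y))
    (x : X) (y : Y) : Prop :=
  ∃ R, IsGBisim δX δY R ∧ R x y

/-- Simulations between `G`-coalgebras. -/
def IsGSim (δX : X → At → Bool ⊕ (Act × X)) (δY : Y → At → Bool ⊕ (Act × Y))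
    (R : X → Y → Prop) : Prop :=
  ∀ x y, R x y → ∀ α : At,
    (δX x α = Sum.inl true → δY y α = Sum.inl true) ∧
    (∀ p x', δX x α = Sum.inr (p, x') → ∃ y', δY y α = Sum.inr (p, y') ∧ R x' y')

/-- Similarity of states of `G`-coalgebras. -/
def GSimilar (δX : X → At → Bool ⊕ (Act × X)) (δY : Y → At → Bool ⊕ (Act × Y))
    (x : X) (y : Y) : Prop :=
  ∃ R, IsGSim δX δY R ∧ R x y

/-- Observation tables for the `GL*` algorithm. -/
structure ObsTable (At Act : Type*) where
  S : Set (List (At × Act))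
  E : Set (GS At Act)
  row : List (At × Act) → Set (GS At Act)
  eps_mem : [] ∈ S
  atoms_mem : ∀ α : At, (([], α) : GS At Act) ∈ E
  prefix_closed : ∀ (s : List (At × Act)) (α : At) (p : Act), s ++ [(α, p)] ∈ S → s ∈ S
  suffix_closed : ∀ (α : At) (p : Act) (e : GS At Act), (((α, p) :: e.1, e.2) : GS At Act) ∈ E → e ∈ E
  row_sub : ∀ t, row t ⊆ E
  rows_distinct : ∀ s ∈ S, ∀ t ∈ S, row s = row t → s = t
  row_nonempty : ∀ s ∈ S, s ≠ [] → (row s).Nonempty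
  row_compat : ∀ s ∈ S, ∀ (α : At) (p : Act) (e : GS At Act),
      (((α, p) :: e.1, e.2) : GS At Act) ∈ E →
      (e ∈ row (s ++ [(α, p)]) ↔ (((α, p) :: e.1, e.2) : GS At Act) ∈ row s)

/-- A table is deterministic if all of its upper rows are deterministic languages. -/
def ObsTable.Det (T : ObsTable At Act) : Prop := ∀ s ∈ T.S, GDetLang (T.row s)

/-- A table is closed if every nonzero lower row equals some upper row. -/
def ObsTable.Closed (T : ObsTable At Act) : Prop :=
  ∀ s ∈ T.S, ∀ (α : At) (p : Act), (T.row (s ++ [(α, p)])).Nonempty →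
    ∃ t ∈ T.S, T.row t = T.row (s ++ [(α, p)])

/-- The transition map of the hypothesis automaton `m(T)` (defined on all of `Set GS`). -/
noncomputable def hypDelta (T : ObsTable At Act) :
    Set (GS At Act) → At → Bool ⊕ (Act × Set (GS At Act)) := fun L α =>
  if h : ∃ s, s ∈ T.S ∧ T.row s = L then
    if hp : ∃ p : Act, (T.row (h.choose ++ [(α, p)])).Nonempty then
      Sum.inr (hp.choose, T.row (h.choose ++ [(α, hp.choose)]))
    else if (([], α) : GS At Act) ∈ L then Sum.inl true
    else Sum.inl false
  else Sum.inl false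

/-- The state space `{row(s) | s ∈ S}` of the hypothesis automaton `m(T)`. -/
def HypStates (T : ObsTable At Act) : Set (Set (GS At Act)) := T.row '' T.S

/-- A `G`-automaton `(Y, δY, y)` is consistent with an observation table `T`. -/
def ConsistentWith (T : ObsTable At Act) (δY : Y → At → Bool ⊕ (Act × Y)) (y : Y) : Prop :=
  T.S ⊆ gRWords δY y ∧
  ∀ s ∈ T.S, ∀ ys, GReaches δY y s ys → ∀ e ∈ T.E, (e ∈ glang δY ys ↔ e ∈ T.row s)

/-- Guarded-string suffixes of a guarded string (auxiliary version). -/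
def gsufAux : List (At × Act) → At → Set (GS At Act)
  | [], β => {(([] : List (At × Act)), β)}
  | ap :: w, β => insert ((ap :: w, β) : GS At Act) (gsufAux w β)

/-- The set `suf(z)` of guarded-string suffixes of a guarded string `z`. -/
def gsuf (z : GS At Act) : Set (GS At Act) := gsufAux z.1 z.2

/-- Acceptance for Moore automata with input `At·Σ` and output `2^At`. -/
def MAccepts (tr : Y → (At × Act) → Y) (out : Y → At → Bool) : Y → List (At × Act) → At → Prop
  | y, [], β => out y β = true
  | y, ap :: w, β => MAccepts tr out (tr y ap) w β

/-- The language of a state of a Moore automaton with input `At·Σ` and output `2^At`. -/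
def mlang (tr : Y → (At × Act) → Y) (out : Y → At → Bool) (y : Y) : Set (GS At Act) :=
  {g | MAccepts tr out y g.1 g.2}

/-- Transition map of the Moore automaton `f(𝒳)` obtained from a `G`-automaton
by adding a sink state `⋆` (`= none`). -/
noncomputable def fTrans (δ : X → At → Bool ⊕ (Act × X)) : Option X → (At × Act) → Option X :=
  fun s ap =>
    match s with
    | none => none
    | some y =>
      match δ y ap.1 with
      | Sum.inl _ => none
      | Sum.inr (q, z) => if q = ap.2 then some z else none

/-- Output map of the Moore automaton `f(𝒳)`. -/
noncomputable def fOut (δ : X → At → Bool ⊕ (Act × X)) : Option X → At → Bool :=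
  fun s α =>
    match s with
    | none => false
    | some y => if δ y α = Sum.inl true then true else false

/-- The injection `π` sending `row(s)` to `s⁻¹⟦𝒳⟧`. -/
noncomputable def piT {At Act X : Type*} (T : ObsTable At Act)
    (δ : X → At → Bool ⊕ (Act × X)) (x : X) (L : Set (GS At Act)) : Set (GS At Act) :=
  if h : ∃ s, s ∈ T.S ∧ T.row s = L then gderiv h.choose (glang δ x) else ∅

theorem GReaches.nil_iff {δ : X → At → Bool ⊕ (Act × X)} {x y : X} :
    GReaches δ x [] y ↔ y = x := by
  constructor
  · intro h
    generalize hw : ([] : List (At × Act)) = w at h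
    cases h <;> simp_all
  · rintro rfl
    exact .refl _

theorem GReaches.append_singleton_iff {δ : X → At → Bool ⊕ (Act × X)} {x z : X}
    {v : List (At × Act)} {α : At} {p : Act} :
    GReaches δ x (v ++ [(α, p)]) z ↔ ∃ y, GReaches δ x v y ∧ δ y α = Sum.inr (p, z) := by
  constructor
  · intro h
    generalize hw : v ++ [(α, p)] = w at h
    cases h with
    | refl => simp at hw
    | single h =>
      obtain ⟨rfl, hap⟩ := List.append_inj' (s₂ := []) hw rfl
      simp only [List.cons.injEq, Prod.mk.injEq, and_true] at hap
      obtain ⟨rfl, rfl⟩ := hap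
      exact ⟨x, .refl x, h⟩
    | snoc hr h =>
      obtain ⟨rfl, hap⟩ := List.append_inj' hw rfl
      simp only [List.cons.injEq, Prod.mk.injEq, and_true] at hap
      obtain ⟨rfl, rfl⟩ := hap
      exact ⟨_, hr, h⟩
  · rintro ⟨y, hr, h⟩
    exact hr.snoc h

theorem GReaches.unique {δ : X → At → Bool ⊕ (Act × X)} {x : X} {w : List (At × Act)} :
    ∀ {y z : X}, GReaches δ x w y → GReaches δ x w z → y = z := by
  induction w using List.reverseRecOn with
  | nil =>
    intro y z hy hz
    rw [GReaches.nil_iff] at hy hz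
    rw [hy, hz]
  | append_singleton v ap ih =>
    obtain ⟨α, p⟩ := ap
    intro y z hy hz
    obtain ⟨y', hy', ey⟩ := GReaches.append_singleton_iff.1 hy
    obtain ⟨z', hz', ez⟩ := GReaches.append_singleton_iff.1 hz
    obtain rfl := ih hy' hz'
    rw [ey] at ez
    simpa using ez

theorem GReaches.mem_of_closed {δ : X → At → Bool ⊕ (Act × X)} {A : Set X}
    (hA : ∀ y ∈ A, ∀ α p z, δ y α = Sum.inr (p, z) → z ∈ A) {x y : X} {w : List (At × Act)}
    (h : GReaches δ x w y) (hx : x ∈ A) : y ∈ A := by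
  induction h with
  | refl => exact hx
  | single h => exact hA _ hx _ _ _ h
  | snoc _ h ih => exact hA _ ih _ _ _ h

theorem GAccepts.append_iff {δ : X → At → Bool ⊕ (Act × X)} {x : X} {w : List (At × Act)} :
    ∀ {u : List (At × Act)} {β : At},
      GAccepts δ x (w ++ u) β ↔ ∃ y, GReaches δ x w y ∧ GAccepts δ y u β := by
  induction w using List.reverseRecOn with
  | nil => simp [GReaches.nil_iff]
  | append_singleton v ap ih =>
    obtain ⟨α, p⟩ := ap
    intro u β
    rw [List.append_assoc, ih]
    simp only [List.singleton_append, GAccepts, GReaches.append_singleton_iff]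
    constructor
    · rintro ⟨y, hr, z, h, ha⟩
      exact ⟨z, ⟨y, hr, h⟩, ha⟩
    · rintro ⟨z, ⟨y, hr, h⟩, ha⟩
      exact ⟨y, hr, z, h, ha⟩

theorem gderiv_glang {δ : X → At → Bool ⊕ (Act × X)} {x y : X} {w : List (At × Act)}
    (h : GReaches δ x w y) : gderiv w (glang δ x) = glang δ y := by
  ext u
  simp only [gderiv, glang, Set.mem_ofPred_eq, GAccepts.append_iff]
  constructor
  · rintro ⟨z, hz, ha⟩
    rwa [h.unique hz]
  · exact fun ha => ⟨y, h, ha⟩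

theorem exists_greaches_of_gderiv_nonempty {δ : X → At → Bool ⊕ (Act × X)} {x : X}
    {w : List (At × Act)} (h : (gderiv w (glang δ x)).Nonempty) : ∃ y, GReaches δ x w y := by
  obtain ⟨u, hu⟩ := h
  obtain ⟨y, hy, -⟩ := GAccepts.append_iff.1 hu
  exact ⟨y, hy⟩

theorem gderiv_gderiv (v w : List (At × Act)) (L : Set (GS At Act)) :
    gderiv w (gderiv v L) = gderiv (v ++ w) L := by
  ext u
  simp [gderiv]

/-- A state whose language contains a string starting with `αp` moves along `αp`. -/
theorem exists_step_of_gderiv_nonempty {δ : X → At → Bool ⊕ (Act × X)} {x : X} {α : At} {p : Act}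
    (h : (gderiv [(α, p)] (glang δ x)).Nonempty) : ∃ y, δ x α = Sum.inr (p, y) := by
  obtain ⟨u, y, hy, -⟩ := h
  exact ⟨y, hy⟩

theorem minDelta_of_gderiv_nonempty {δ : X → At → Bool ⊕ (Act × X)} {x : X} {α : At} {p : Act}
    (h : (gderiv [(α, p)] (glang δ x)).Nonempty) :
    minDelta (glang δ x) α = Sum.inr (p, gderiv [(α, p)] (glang δ x)) := by
  have hex : ∃ q : Act, (gderiv [(α, q)] (glang δ x)).Nonempty := ⟨p, h⟩
  have hq : hex.choose = p := by
    obtain ⟨y, hy⟩ := exists_step_of_gderiv_nonempty hex.choose_spec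
    obtain ⟨z, hz⟩ := exists_step_of_gderiv_nonempty h
    rw [hy] at hz
    simp only [Sum.inr.injEq, Prod.mk.injEq] at hz
    exact hz.1
  rw [minDelta, dif_pos hex, hq]

theorem minDelta_of_inl {δ : X → At → Bool ⊕ (Act × X)} {x : X} {α : At} {b : Bool}
    (h : δ x α = Sum.inl b) : minDelta (glang δ x) α = Sum.inl b := by
  have hne : ¬ ∃ q : Act, (gderiv [(α, q)] (glang δ x)).Nonempty := by
    rintro ⟨q, hq⟩
    obtain ⟨y, hy⟩ := exists_step_of_gderiv_nonempty hq
    simp [h] at hy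
  rw [minDelta, dif_neg hne]
  cases b <;> simp [glang, GAccepts, h]

/-- A homomorphism defined on a closed set of states preserves acceptance. -/
theorem GAccepts.map_iff {δX : X → At → Bool ⊕ (Act × X)} {δY : Y → At → Bool ⊕ (Act × Y)}
    {A : Set X} {f : X → Y}
    (hA : ∀ y ∈ A, ∀ α p z, δX y α = Sum.inr (p, z) → z ∈ A)
    (hf : ∀ y ∈ A, ∀ α, (∀ b, δX y α = Sum.inl b → δY (f y) α = Sum.inl b) ∧
      ∀ p z, δX y α = Sum.inr (p, z) → δY (f y) α = Sum.inr (p, f z))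
    {w : List (At × Act)} {β : At} :
    ∀ {x : X}, x ∈ A → (GAccepts δX x w β ↔ GAccepts δY (f x) w β) := by
  induction w with
  | nil =>
    intro x hx
    simp only [GAccepts]
    rcases h : δX x β with b | ⟨p, z⟩
    · simp [(hf x hx β).1 b h]
    · simp [(hf x hx β).2 p z h]
  | cons ap w ih =>
    obtain ⟨α, p⟩ := ap
    intro x hx
    simp only [GAccepts]
    rcases h : δX x α with b | ⟨q, z⟩
    · simp [(hf x hx α).1 b h]
    · simp only [(hf x hx α).2 q z h, Sum.inr.injEq, Prod.mk.injEq]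
      have := ih (hA x hx α q z h)
      grind

theorem piT_row (T : ObsTable At Act) (δ : X → At → Bool ⊕ (Act × X)) (x : X)
    {s : List (At × Act)} (hs : s ∈ T.S) : piT T δ x (T.row s) = gderiv s (glang δ x) := by
  have hex : ∃ t, t ∈ T.S ∧ T.row t = T.row s := ⟨s, hs, rfl⟩
  rw [piT, dif_pos hex, T.rows_distinct _ hex.choose_spec.1 _ hs hex.choose_spec.2]

theorem hypDelta_row (T : ObsTable At Act) {s : List (At × Act)} (hs : s ∈ T.S) (α : At) :
    hypDelta T (T.row s) α =
      if hp : ∃ p : Act, (T.row (s ++ [(α, p)])).Nonempty then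
        Sum.inr (hp.choose, T.row (s ++ [(α, hp.choose)]))
      else if (([], α) : GS At Act) ∈ T.row s then Sum.inl true
      else Sum.inl false := by
  have hex : ∃ t, t ∈ T.S ∧ T.row t = T.row s := ⟨s, hs, rfl⟩
  have hch : hex.choose = s := T.rows_distinct _ hex.choose_spec.1 _ hs hex.choose_spec.2
  rw [hypDelta, dif_pos hex, hch]

theorem hypDelta_row_eq_inr {T : ObsTable At Act} {s : List (At × Act)} (hs : s ∈ T.S)
    {α : At} {p : Act} {L : Set (GS At Act)} (h : hypDelta T (T.row s) α = Sum.inr (p, L)) :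
    L = T.row (s ++ [(α, p)]) ∧ L.Nonempty := by
  rw [hypDelta_row T hs] at h
  split_ifs at h with hp
  simp only [Sum.inr.injEq, Prod.mk.injEq] at h
  obtain ⟨rfl, rfl⟩ := h
  exact ⟨rfl, hp.choose_spec⟩

theorem HypStates.closed {T : ObsTable At Act} (hcl : T.Closed) :
    ∀ K ∈ HypStates T, ∀ α p L, hypDelta T K α = Sum.inr (p, L) → L ∈ HypStates T := by
  rintro _ ⟨s, hs, rfl⟩ α p L h
  obtain ⟨rfl, hne⟩ := hypDelta_row_eq_inr hs h
  exact hcl s hs α p hne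

/-- The entries of `T` record membership in `L`. -/
def ObsTable.Records (T : ObsTable At Act) (L : Set (GS At Act)) : Prop :=
  ∀ t : List (At × Act), (t ∈ T.S ∨ ∃ s ∈ T.S, ∃ (α : At) (p : Act), t = s ++ [(α, p)]) →
    ∀ e ∈ T.E, (e ∈ T.row t ↔ ((t ++ e.1, e.2) : GS At Act) ∈ L)

namespace ObsTable.Records

variable {T : ObsTable At Act} {δ : X → At → Bool ⊕ (Act × X)} {x : X}

theorem row_eq {L : Set (GS At Act)} (hrow : T.Records L) {s : List (At × Act)} (hs : s ∈ T.S) :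
    T.row s = T.E ∩ gderiv s L := by
  ext e
  exact ⟨fun h => ⟨T.row_sub s h, (hrow s (.inl hs) e (T.row_sub s h)).1 h⟩,
    fun h => (hrow s (.inl hs) e h.1).2 h.2⟩

theorem gderiv_nonempty {L : Set (GS At Act)} (hrow : T.Records L) {t : List (At × Act)}
    (ht : t ∈ T.S ∨ ∃ s ∈ T.S, ∃ (α : At) (p : Act), t = s ++ [(α, p)])
    (hne : (T.row t).Nonempty) : (gderiv t L).Nonempty := by
  obtain ⟨e, he⟩ := hne
  exact ⟨e, (hrow t ht e (T.row_sub t he)).1 he⟩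

theorem exists_greaches (hrow : T.Records (glang δ x)) {s : List (At × Act)} (hs : s ∈ T.S) :
    ∃ y, GReaches δ x s y := by
  by_cases h : s = []
  · exact ⟨x, h ▸ .refl x⟩
  · exact exists_greaches_of_gderiv_nonempty
      (hrow.gderiv_nonempty (.inl hs) (T.row_nonempty s hs h))

theorem hypDelta_row_eq (hrow : T.Records (glang δ x)) {s : List (At × Act)} (hs : s ∈ T.S)
    {α : At} {p : Act} (hne : (T.row (s ++ [(α, p)])).Nonempty) :
    hypDelta T (T.row s) α = Sum.inr (p, T.row (s ++ [(α, p)])) := by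
  have hex : ∃ q : Act, (T.row (s ++ [(α, q)])).Nonempty := ⟨p, hne⟩
  have hstep : ∀ q, (T.row (s ++ [(α, q)])).Nonempty →
      ∃ y z, GReaches δ x s y ∧ δ y α = Sum.inr (q, z) := by
    intro q hq
    obtain ⟨z, hz⟩ := exists_greaches_of_gderiv_nonempty
      (hrow.gderiv_nonempty (.inr ⟨s, hs, α, q, rfl⟩) hq)
    obtain ⟨y, hy, h⟩ := GReaches.append_singleton_iff.1 hz
    exact ⟨y, z, hy, h⟩
  have hq : hex.choose = p := by
    obtain ⟨y, z, hy, h⟩ := hstep _ hex.choose_spec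
    obtain ⟨y', z', hy', h'⟩ := hstep _ hne
    obtain rfl := hy.unique hy'
    rw [h] at h'
    simp only [Sum.inr.injEq, Prod.mk.injEq] at h'
    exact h'.1
  rw [hypDelta_row T hs, dif_pos hex, hq]

/-- In the hypothesis automaton, every `s ∈ S` leads from the initial state to `row s`. -/
theorem greaches_row (hrow : T.Records (glang δ x)) {s : List (At × Act)} (hs : s ∈ T.S) :
    GReaches (hypDelta T) (T.row []) s (T.row s) := by
  induction s using List.reverseRecOn with
  | nil => exact .refl _
  | append_singleton v ap ih =>
    obtain ⟨α, p⟩ := ap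
    have hv := T.prefix_closed v α p hs
    exact (ih hv).snoc (hrow.hypDelta_row_eq hv (T.row_nonempty _ hs (by simp)))

theorem injOn_piT (hrow : T.Records (glang δ x)) : Set.InjOn (piT T δ x) (HypStates T) := by
  rintro _ ⟨s, hs, rfl⟩ _ ⟨t, ht, rfl⟩ h
  rw [piT_row T δ x hs, piT_row T δ x ht] at h
  rw [hrow.row_eq hs, hrow.row_eq ht, h]

theorem mapsTo_piT (hrow : T.Records (glang δ x)) :
    Set.MapsTo (piT T δ x) (HypStates T) (MinStates δ x) := by
  rintro _ ⟨s, hs, rfl⟩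
  exact ⟨s, hrow.exists_greaches hs, piT_row T δ x hs⟩

/-- If the hypothesis accepts the target language, `π` sends a state to its language. -/
theorem piT_eq_glang (hrow : T.Records (glang δ x))
    (h : glang (hypDelta T) (T.row []) = glang δ x) {K : Set (GS At Act)}
    (hK : K ∈ HypStates T) : piT T δ x K = glang (hypDelta T) K := by
  obtain ⟨s, hs, rfl⟩ := hK
  rw [piT_row T δ x hs, ← h, gderiv_glang (hrow.greaches_row hs)]

theorem surjOn_piT (hrow : T.Records (glang δ x)) (hN : GNormal δ) (hcl : T.Closed)
    (h : glang (hypDelta T) (T.row []) = glang δ x) :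
    Set.SurjOn (piT T δ x) (HypStates T) (MinStates δ x) := by
  rintro _ ⟨w, ⟨y, hy⟩, rfl⟩
  have hinit : T.row [] ∈ HypStates T := ⟨[], T.eps_mem, rfl⟩
  obtain ⟨K, hK⟩ : ∃ K, GReaches (hypDelta T) (T.row []) w K := by
    cases w using List.reverseRecOn with
    | nil => exact ⟨_, .refl _⟩
    | append_singleton v ap =>
      obtain ⟨α, p⟩ := ap
      obtain ⟨z, -, hz⟩ := GReaches.append_singleton_iff.1 hy
      apply exists_greaches_of_gderiv_nonempty
      rw [h, gderiv_glang hy]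
      exact hN _ _ _ _ hz
  have hKmem := hK.mem_of_closed (HypStates.closed hcl) hinit
  exact ⟨K, hKmem, by rw [hrow.piT_eq_glang h hKmem, ← gderiv_glang hK, h]⟩

end ObsTable.Records

theorem minDelta_step_of_gnormal {δ : X → At → Bool ⊕ (Act × X)} (hN : GNormal δ) {x y : X}
    {α : At} {p : Act} (h : δ x α = Sum.inr (p, y)) :
    minDelta (glang δ x) α = Sum.inr (p, glang δ y) := by
  have hd : gderiv [(α, p)] (glang δ x) = glang δ y := gderiv_glang (.single h)
  rw [minDelta_of_gderiv_nonempty (hd ▸ hN _ _ _ _ h), hd]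

theorem glang_minDelta {δ : X → At → Bool ⊕ (Act × X)} (hN : GNormal δ) (x : X) :
    glang minDelta (glang δ x) = glang δ x := by
  ext u
  exact (GAccepts.map_iff (A := Set.univ) (f := glang δ) (fun _ _ _ _ _ _ => trivial)
    (fun _ _ _ => ⟨fun _ => minDelta_of_inl, fun _ _ => minDelta_step_of_gnormal hN⟩)
    (Set.mem_univ x)).symm

/-- `π` is a `G`-automata isomorphism `m(T) ≅ m(𝒳)` iff
`⟦m(T)⟧ = ⟦m(𝒳)⟧`. -/
theorem pi_iso_iff_lang_eq {At Act : Type*} [Fintype At] [Nonempty At] [Fintype Act] [Nonempty Act] {X : Type*} [Fintype X]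
    (δ : X → At → Bool ⊕ (Act × X)) (x : X) (hN : GNormal δ)
    (T : ObsTable At Act) (hdet : T.Det) (hcl : T.Closed)
    (hrow : ∀ t : List (At × Act),
      (t ∈ T.S ∨ ∃ s ∈ T.S, ∃ (α : At) (p : Act), t = s ++ [(α, p)]) →
      ∀ e ∈ T.E, (e ∈ T.row t ↔ ((t ++ e.1, e.2) : GS At Act) ∈ glang δ x)) :
    (Set.BijOn (piT T δ x) (HypStates T) (MinStates δ x) ∧
     piT T δ x (T.row []) = glang δ x ∧
     (∀ L ∈ HypStates T, ∀ α : At,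
       (∀ b : Bool, hypDelta T L α = Sum.inl b → minDelta (piT T δ x L) α = Sum.inl b) ∧
       (∀ (p : Act) (L' : Set (GS At Act)), hypDelta T L α = Sum.inr (p, L') →
           minDelta (piT T δ x L) α = Sum.inr (p, piT T δ x L')))) ↔
    glang (hypDelta T) (T.row []) = glang minDelta (glang δ x) := by
  have hrec : T.Records (glang δ x) := hrow
  have hinit : T.row [] ∈ HypStates T := ⟨[], T.eps_mem, rfl⟩
  have hpi : piT T δ x (T.row []) = glang δ x := piT_row T δ x T.eps_mem
  constructor
  · rintro ⟨-, -, hhom⟩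
    ext u
    rw [← hpi]
    exact GAccepts.map_iff (HypStates.closed hcl) hhom hinit
  · intro h
    rw [glang_minDelta hN] at h
    refine ⟨⟨hrec.mapsTo_piT, hrec.injOn_piT, hrec.surjOn_piT hN hcl h⟩, hpi, fun K hK α => ⟨?_, ?_⟩⟩
    · intro b hb
      rw [hrec.piT_eq_glang h hK]
      exact minDelta_of_inl hb
    · intro p L hL
      have hd := gderiv_glang (GReaches.single hL)
      rw [hrec.piT_eq_glang h (HypStates.closed hcl K hK α p L hL), hrec.piT_eq_glang h hK, ← hd]
      apply minDelta_of_gderiv_nonempty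
      rw [← hrec.piT_eq_glang h hK]
      obtain ⟨s, hs, rfl⟩ := hK
      obtain ⟨rfl, hne⟩ := hypDelta_row_eq_inr hs hL
      rw [piT_row T δ x hs, gderiv_gderiv]
      exact hrec.gderiv_nonempty (.inr ⟨s, hs, α, p, rfl⟩) hne
end

section
/- Let 𝒳 be a normal G-automaton accepting a nonempty language, i.e. ⟦𝒳⟧ ≠ ∅. Then the M-automaton f(m(𝒳)) obtained by embedding the minimization of 𝒳 is isomorphic (as an M-automaton) to the minimal M-automaton of the language ⟦𝒳⟧, namely the M-automaton with states all derivatives {w⁻¹⟦𝒳⟧ | w ∈ (At·Σ)*}, initial state ⟦𝒳⟧, transition ∂(K)(αp) = (αp)⁻¹K, and output ε(K)(α) = 1 iff α ∈ K. -/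
open scoped Classical

variable {At Act X Y : Type*}

section Derivatives

variable {δ : X → At → Bool ⊕ (Act × X)}

theorem gderiv_append (v w : List (At × Act)) (L : Set (GS At Act)) :
    gderiv (v ++ w) L = gderiv w (gderiv v L) := by
  ext u
  simp [gderiv]

theorem gderiv_empty (w : List (At × Act)) : gderiv w (∅ : Set (GS At Act)) = ∅ := rfl

theorem nil_mem_glang_iff {x : X} {α : At} :
    (([], α) : GS At Act) ∈ glang δ x ↔ δ x α = Sum.inl true := Iff.rfl

theorem mem_gderiv_singleton_glang_iff {x : X} {α : At} {p : Act} {u : GS At Act} :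
    u ∈ gderiv [(α, p)] (glang δ x) ↔ ∃ y, δ x α = Sum.inr (p, y) ∧ u ∈ glang δ y := Iff.rfl

theorem gderiv_singleton_glang {x y : X} {α : At} {p : Act} (h : δ x α = Sum.inr (p, y)) :
    gderiv [(α, p)] (glang δ x) = glang δ y := by
  ext u
  simp [mem_gderiv_singleton_glang_iff, h]

theorem exists_of_gderiv_singleton_glang_nonempty {x : X} {α : At} {p : Act}
    (h : (gderiv [(α, p)] (glang δ x)).Nonempty) : ∃ y, δ x α = Sum.inr (p, y) := by
  obtain ⟨u, y, hy, -⟩ := h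
  exact ⟨y, hy⟩

theorem gderiv_glang_of_reaches {x y : X} {w : List (At × Act)} (h : GReaches δ x w y) :
    gderiv w (glang δ x) = glang δ y := by
  induction h with
  | refl => rfl
  | single h => exact gderiv_singleton_glang h
  | snoc _ h ih => rw [gderiv_append, ih, gderiv_singleton_glang h]

theorem exists_reaches_of_gderiv_nonempty {x : X} {w : List (At × Act)}
    (h : (gderiv w (glang δ x)).Nonempty) : ∃ y, GReaches δ x w y := by
  induction w using List.reverseRecOn with
  | nil => exact ⟨x, .refl x⟩
  | append_singleton v ap ih =>
    rw [gderiv_append] at h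
    have hv : (gderiv v (glang δ x)).Nonempty := by
      obtain ⟨u, hu⟩ := h
      exact ⟨_, hu⟩
    obtain ⟨y, hy⟩ := ih hv
    rw [gderiv_glang_of_reaches hy] at h
    obtain ⟨z, hz⟩ := exists_of_gderiv_singleton_glang_nonempty h
    exact ⟨z, .snoc hy hz⟩

theorem GNormal.glang_nonempty_of_reaches (hN : GNormal δ) {x y : X} {w : List (At × Act)}
    (hne : (glang δ x).Nonempty) (h : GReaches δ x w y) : (glang δ y).Nonempty := by
  cases h with
  | refl => exact hne
  | single h => exact hN _ _ _ _ h
  | snoc _ h => exact hN _ _ _ _ h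

/-- Extending an accepted guarded string by any action leaves the language. -/
theorem exists_gderiv_glang_eq_empty [Nonempty Act] {x : X} (hne : (glang δ x).Nonempty) :
    ∃ w : List (At × Act), gderiv w (glang δ x) = ∅ := by
  obtain ⟨⟨u, α⟩, hu⟩ := hne
  have hmem : (([], α) : GS At Act) ∈ gderiv u (glang δ x) := by simpa [gderiv] using hu
  obtain ⟨y, hy⟩ := exists_reaches_of_gderiv_nonempty ⟨_, hmem⟩
  rw [gderiv_glang_of_reaches hy, nil_mem_glang_iff] at hmem
  refine ⟨u ++ [(α, Classical.arbitrary Act)], ?_⟩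
  rw [gderiv_append, gderiv_glang_of_reaches hy]
  by_contra hcon
  obtain ⟨z, hz⟩ :=
    exists_of_gderiv_singleton_glang_nonempty (Set.nonempty_iff_ne_empty.mpr hcon)
  simp [hmem] at hz

theorem fTrans_minDelta_glang (x : X) (ap : At × Act) :
    (fTrans minDelta (some (glang δ x)) ap).getD ∅ = gderiv [ap] (glang δ x) := by
  obtain ⟨α, p⟩ := ap
  by_cases h : ∃ q : Act, (gderiv [(α, q)] (glang δ x)).Nonempty
  · simp only [fTrans, minDelta, dif_pos h]
    split_ifs with hq
    · simp [hq]
    · by_contra hcon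
      obtain ⟨y, hy⟩ := exists_of_gderiv_singleton_glang_nonempty
        (Set.nonempty_iff_ne_empty.mpr (Ne.symm hcon))
      obtain ⟨z, hz⟩ := exists_of_gderiv_singleton_glang_nonempty h.choose_spec
      rw [hy] at hz
      simp only [Sum.inr.injEq, Prod.mk.injEq] at hz
      exact hq hz.1.symm
  · have hp : gderiv [(α, p)] (glang δ x) = ∅ :=
      Set.not_nonempty_iff_eq_empty.mp fun hp => h ⟨p, hp⟩
    by_cases hα : (([], α) : GS At Act) ∈ glang δ x <;>
      simp [fTrans, minDelta, dif_neg h, hα, hp]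

theorem fOut_minDelta_glang (x : X) (α : At) :
    fOut minDelta (some (glang δ x)) α = true ↔ (([], α) : GS At Act) ∈ glang δ x := by
  by_cases h : ∃ q : Act, (gderiv [(α, q)] (glang δ x)).Nonempty
  · obtain ⟨y, hy⟩ := exists_of_gderiv_singleton_glang_nonempty h.choose_spec
    simp [fOut, minDelta, dif_pos h, nil_mem_glang_iff, hy]
  · by_cases hα : (([], α) : GS At Act) ∈ glang δ x <;>
      simp [fOut, minDelta, dif_neg h, hα]

theorem exists_reaches_eq_glang_of_mem_MinStates {x : X} {L : Set (GS At Act)}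
    (h : L ∈ MinStates δ x) : ∃ w y, GReaches δ x w y ∧ L = glang δ y := by
  obtain ⟨w, ⟨y, hy⟩, rfl⟩ := h
  exact ⟨w, y, hy, gderiv_glang_of_reaches hy⟩

theorem GNormal.nonempty_of_mem_MinStates (hN : GNormal δ) {x : X} {L : Set (GS At Act)}
    (hne : (glang δ x).Nonempty) (h : L ∈ MinStates δ x) : L.Nonempty := by
  obtain ⟨w, y, hy, rfl⟩ := exists_reaches_eq_glang_of_mem_MinStates h
  exact hN.glang_nonempty_of_reaches hne hy

end Derivatives

/-- for a normal `G`-automaton with nonempty language, `f(m(𝒳))` is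
isomorphic, as a Moore automaton, to the minimal Moore automaton of `⟦𝒳⟧` (whose states
are all derivatives of `⟦𝒳⟧`). -/
theorem min_embedding_iso {At Act : Type*} [Fintype At] [Nonempty At] [Fintype Act] [Nonempty Act] {X : Type*}
    (δ : X → At → Bool ⊕ (Act × X)) (x : X) (hN : GNormal δ)
    (hne : (glang δ x).Nonempty) :
    ∃ g : Option (Set (GS At Act)) → Set (GS At Act),
      Set.BijOn g (insert none (some '' MinStates δ x))
        {K | ∃ w : List (At × Act), K = gderiv w (glang δ x)} ∧
      g (some (glang δ x)) = glang δ x ∧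
      (∀ s ∈ insert none (some '' MinStates δ x), ∀ ap : At × Act,
        g (fTrans minDelta s ap) = gderiv [ap] (g s)) ∧
      (∀ s ∈ insert none (some '' MinStates δ x), ∀ α : At,
        (fOut minDelta s α = true ↔ (([], α) : GS At Act) ∈ g s)) := by
  refine ⟨fun s => s.getD ∅, ⟨?_, ?_, ?_⟩, rfl, ?_, ?_⟩
  · rintro s (rfl | ⟨L, ⟨w, -, rfl⟩, rfl⟩)
    · obtain ⟨w, hw⟩ := exists_gderiv_glang_eq_empty hne
      exact ⟨w, hw.symm⟩
    · exact ⟨w, rfl⟩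
  · rintro s (rfl | ⟨L, hL, rfl⟩) t (rfl | ⟨K, hK, rfl⟩) hst
    · rfl
    · exact absurd hst.symm (hN.nonempty_of_mem_MinStates hne hK).ne_empty
    · exact absurd hst (hN.nonempty_of_mem_MinStates hne hL).ne_empty
    · exact congrArg some hst
  · rintro K ⟨w, rfl⟩
    by_cases hw : (gderiv w (glang δ x)).Nonempty
    · exact ⟨some _, Or.inr ⟨_, ⟨w, exists_reaches_of_gderiv_nonempty hw, rfl⟩, rfl⟩, rfl⟩
    · exact ⟨none, Or.inl rfl, (Set.not_nonempty_iff_eq_empty.mp hw).symm⟩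
  · rintro s (rfl | ⟨L, hL, rfl⟩) ap
    · exact (gderiv_empty [ap]).symm
    · obtain ⟨w, y, -, rfl⟩ := exists_reaches_eq_glang_of_mem_MinStates hL
      exact fTrans_minDelta_glang y ap
  · rintro s (rfl | ⟨L, hL, rfl⟩) α
    · simp [fOut]
    · obtain ⟨w, y, -, rfl⟩ := exists_reaches_eq_glang_of_mem_MinStates hL
      exact fOut_minDelta_glang y α
end
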